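/- arXiv:2110.03388 — 5 statements merged into one kernel-verified Lean document; each statement's English description precedes it below -/
import Mathlib

section
/- For every positive natural number n and every integer m, n·(2·arctan(1/2)) ≠ 2·π·m. In other words, successive rotations by the angle θ = 2·arctan(1/2) never return the orientation to its original state, so all integer multiples of θ are distinct modulo 2π. -/
theorem cos_two_mul_arctan (x : ℝ) :
    Real.cos (2 * Real.arctan x) = (1 - x ^ 2) / (1 + x ^ 2) := by
  rw [Real.cos_two_mul, Real.cos_sq_arctan]
  have : 1 + x ^ 2 ≠ 0 := by positivity
  field_simp
  ring

theorem cos_two_mul_arctan_half : Real.cos (2 * Real.arctan (1 / 2)) = 3 / 5 := by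
  rw [cos_two_mul_arctan]
  norm_num

/-- For every positive natural number n and every integer m,
n·(2·arctan(1/2)) ≠ 2·π·m: successive rotations by θ = 2·arctan(1/2) never
return to the original orientation. -/
theorem multiples_of_two_arctan_half_ne_multiples_of_two_pi
    (n : ℕ) (hn : 0 < n) (m : ℤ) :
    (n : ℝ) * (2 * Real.arctan (1/2)) ≠ 2 * Real.pi * (m : ℝ) := by
  intro h
  have hn' : (n : ℝ) ≠ 0 := by positivity
  have hangle : ∃ r : ℚ, 2 * Real.arctan (1 / 2) = r * Real.pi := by
    refine ⟨2 * m / n, ?_⟩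
    push_cast
    rw [div_mul_eq_mul_div, eq_div_iff hn']
    linarith
  have hcos := niven hangle ⟨3 / 5, by rw [cos_two_mul_arctan_half]; norm_num⟩
  rw [cos_two_mul_arctan_half] at hcos
  norm_num at hcos
end

section
/- The set of points {n·(2·arctan(1/2)) mod 2π : n ∈ ℕ} is dense in the circle ℝ/2πℤ; that is, the orbit of the rotation by the angle θ = 2·arctan(1/2) is dense in AddCircle (2π). -/
theorem irrational_two_mul_arctan_half_div_two_pi :
    Irrational (2 * Real.arctan (1 / 2) / (2 * Real.pi)) := by
  rintro ⟨q, hq⟩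
  have h_angle : 2 * Real.arctan (1 / 2) = ((2 * q : ℚ) : ℝ) * Real.pi := by
    push_cast
    rw [hq]
    field_simp
  have h_niven := niven ⟨2 * q, h_angle⟩ ⟨3 / 5, by rw [cos_two_mul_arctan_half]; norm_num⟩
  rw [cos_two_mul_arctan_half] at h_niven
  norm_num at h_niven

/-- The orbit of the rotation by the angle θ = 2·arctan(1/2) is dense in the
circle ℝ/2πℤ. -/
theorem dense_orbit_two_arctan_half :
    Dense (Set.range fun n : ℕ =>
      (((n : ℝ) * (2 * Real.arctan (1/2)) : ℝ) : AddCircle (2 * Real.pi))) := by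
  have : Fact (0 < 2 * Real.pi) := ⟨Real.two_pi_pos⟩
  have h_dense := denseRange_zsmul_iff_nsmul.mp
    (AddCircle.denseRange_zsmul_coe_iff.mpr irrational_two_mul_arctan_half_div_two_pi)
  simpa only [DenseRange, ← AddCircle.coe_nsmul, nsmul_eq_mul] using h_dense
end

section
/- Let A, B, C be three points in the Euclidean plane ℝ² and let 0 ≤ ε < π/2. If the internal angle of the triangle at A (the angle ∠CAB) and the internal angle at B (the angle ∠ABC) are both at most ε, then dist(A,C) + dist(C,B) ≤ dist(A,B) / cos(ε). -/
open EuclideanGeometry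

/-- A lower bound for the inner product of two vectors whose angle is at most `ε`. -/
theorem norm_mul_norm_mul_cos_le_inner {V : Type*} [NormedAddCommGroup V]
    [InnerProductSpace ℝ V] {x y : V} {ε : ℝ} (hε : ε ≤ Real.pi)
    (h : InnerProductGeometry.angle x y ≤ ε) :
    ‖x‖ * ‖y‖ * Real.cos ε ≤ inner ℝ x y := by
  rw [← InnerProductGeometry.cos_angle_mul_norm_mul_norm x y, mul_comm]
  gcongr
  exact Real.cos_le_cos_of_nonneg_of_le_pi (InnerProductGeometry.angle_nonneg x y) hε h

/-- If the internal angles of a triangle in the Euclidean plane at A and at B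
are both at most ε (with 0 ≤ ε < π/2), then
dist(A,C) + dist(C,B) ≤ dist(A,B)/cos ε. -/
theorem two_segment_path_length_le (A B C : EuclideanSpace ℝ (Fin 2)) (ε : ℝ)
    (hε0 : 0 ≤ ε) (hε : ε < Real.pi / 2)
    (hA : EuclideanGeometry.angle C A B ≤ ε)
    (hB : EuclideanGeometry.angle A B C ≤ ε) :
    dist A C + dist C B ≤ dist A B / Real.cos ε := by
  have hcos : 0 < Real.cos ε := Real.cos_pos_of_mem_Ioo ⟨by linarith [Real.pi_pos], hε⟩
  have hAB : A ≠ B := by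
    rintro rfl
    rw [EuclideanGeometry.angle_self_right] at hA
    linarith
  have hpi : ε ≤ Real.pi := by linarith [Real.pi_pos]
  have h₁ := norm_mul_norm_mul_cos_le_inner hpi hA
  have h₂ := norm_mul_norm_mul_cos_le_inner hpi hB
  have hsum : inner ℝ (C -ᵥ A) (B -ᵥ A) + inner ℝ (A -ᵥ B) (C -ᵥ B) = dist A B ^ 2 := by
    rw [← neg_vsub_eq_vsub_rev B A, inner_neg_left, real_inner_comm, ← sub_eq_add_neg,
      ← inner_sub_right, vsub_sub_vsub_cancel_left, real_inner_self_eq_norm_sq,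
      ← dist_eq_norm_vsub, dist_comm]
  simp only [← dist_eq_norm_vsub] at h₁ h₂
  rw [dist_comm C A, dist_comm B A] at h₁
  rw [le_div_iff₀ hcos]
  refine le_of_mul_le_mul_left ?_ (dist_pos.mpr hAB)
  linarith
end

section
/- 4·(cosh(log(2)/2)·sin(π/4))² = 9/4, and 9/4 is a rational number in [0,4] that is not an integer. Consequently, with rapidity w = log 2 and turn angle φ = π/2, the quantity 4·(cosh(w/2)·sin((π−φ)/2))² lies in [0,4] ∩ ℚ \ ℤ. -/
theorem cosh_half_log_two_sq : Real.cosh (Real.log 2 / 2) ^ 2 = 9 / 8 := by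
  have h := Real.cosh_two_mul (Real.log 2 / 2)
  rw [mul_div_cancel₀ _ (two_ne_zero), Real.cosh_log two_pos, Real.sinh_sq] at h
  linarith

theorem sin_pi_div_four_sq : Real.sin (Real.pi / 4) ^ 2 = 1 / 2 := by
  rw [Real.sin_pi_div_four, div_pow, Real.sq_sqrt zero_le_two]
  norm_num

/-- 4·(cosh(log(2)/2)·sin(π/4))² = 9/4, and 9/4 belongs to
[0,4] ∩ ℚ \ ℤ; hence with rapidity w = log 2 and turn angle φ = π/2 the
quantity 4·(cosh(w/2)·sin((π−φ)/2))² lies in [0,4] ∩ ℚ \ ℤ. -/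
theorem lemma_condition_verified :
    4 * (Real.cosh (Real.log 2 / 2) * Real.sin (Real.pi / 4)) ^ 2 = 9/4 ∧
    4 * (Real.cosh (Real.log 2 / 2) *
        Real.sin ((Real.pi - Real.pi / 2) / 2)) ^ 2 ∈
      (Set.Icc (0 : ℝ) 4 ∩ Set.range ((↑) : ℚ → ℝ)) \
        Set.range ((↑) : ℤ → ℝ) := by
  have h : 4 * (Real.cosh (Real.log 2 / 2) * Real.sin (Real.pi / 4)) ^ 2 = 9 / 4 := by
    rw [mul_pow, cosh_half_log_two_sq, sin_pi_div_four_sq]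
    norm_num
  refine ⟨h, ?_⟩
  rw [show (Real.pi - Real.pi / 2) / 2 = Real.pi / 4 by ring, h]
  refine ⟨⟨by norm_num, 9 / 4, by norm_num⟩, ?_⟩
  rintro ⟨n, hn⟩
  have h4 : 4 * n = 9 := by
    have : (4 : ℝ) * n = 9 := by linarith
    exact_mod_cast this
  omega
end

section
/- The set of points {n·(2·arccos(3/4)) mod 2π : n ∈ ℕ} is dense in the circle ℝ/2πℤ; that is, the orbit of the rotation by the angle 2·arccos(3/4) is dense in AddCircle (2π). -/
/-- The arccosine of a rational number in `[-1, 1]` outside Niven's list is an irrational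
multiple of `π`. -/
theorem irrational_arccos_ratCast_div_pi {q : ℚ} (h₁ : -1 ≤ q) (h₂ : q ≤ 1)
    (hq : q ∉ ({-1, -1 / 2, 0, 1 / 2, 1} : Set ℚ)) :
    Irrational (Real.arccos q / Real.pi) := by
  rintro ⟨r, hr⟩
  have hcos : Real.cos (Real.arccos q) = q :=
    Real.cos_arccos (mod_cast h₁) (mod_cast h₂)
  have key := niven ⟨r, (div_eq_iff Real.pi_ne_zero).mp hr.symm⟩ ⟨q, hcos⟩
  rw [hcos] at key
  apply hq
  simp only [Set.mem_insert_iff, Set.mem_singleton_iff, ← @Rat.cast_inj ℝ] at key ⊢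
  push_cast
  exact key

/-- If `a / p` is irrational, then the natural multiples of `a` are dense on a circle of
length `p > 0`. -/
theorem AddCircle.denseRange_nsmul_coe_of_irrational {a p : ℝ} [Fact (0 < p)]
    (h : Irrational (a / p)) : DenseRange (· • a : ℕ → AddCircle p) :=
  denseRange_zsmul_iff_nsmul.mp (AddCircle.denseRange_zsmul_coe_iff.mpr h)

/-- The orbit of the rotation by the angle 2·arccos(3/4) is dense in the
circle ℝ/2πℤ. -/
theorem dense_orbit_two_arccos_three_quarters :
    Dense (Set.range fun n : ℕ =>
      (((n : ℝ) * (2 * Real.arccos (3/4)) : ℝ) : AddCircle (2 * Real.pi))) := by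
  have : Fact (0 < 2 * Real.pi) := ⟨Real.two_pi_pos⟩
  have h : Irrational (2 * Real.arccos (3 / 4) / (2 * Real.pi)) := by
    rw [mul_div_mul_left _ _ two_ne_zero]
    simpa using irrational_arccos_ratCast_div_pi (q := 3 / 4) (by norm_num) (by norm_num)
      (by norm_num)
  simpa [DenseRange, ← nsmul_eq_mul] using AddCircle.denseRange_nsmul_coe_of_irrational h
end
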